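/- For partitions α and β, the Littlewood–Richardson coefficient LR^{□(n,m)}_{α,β} equals 1 if (α, β) is complementary relative to the rectangle □(n,m), and equals 0 otherwise. -/

import Mathlib

open scoped BigOperators

/-- A partition, represented canonically as the multiset of its (positive) parts. -/
structure Ptn where
  parts : Multiset ℕ
  pos : ∀ x ∈ parts, 0 < x

namespace Ptn

/-- Build a partition from an arbitrary multiset of naturals by discarding zero parts. -/
def of (s : Multiset ℕ) : Ptn :=
  ⟨s.filter (fun x => 0 < x), fun _ hx => (Multiset.mem_filter.mp hx).2⟩

/-- The empty partition. -/
def empty : Ptn := ⟨0, by simp⟩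

/-- The `i`-th largest part (`0`-indexed); `0` if `i` is at least the number of parts. -/
def part (l : Ptn) (i : ℕ) : ℕ :=
  ((l.parts.sort (· ≤ ·)).reverse).getD i 0

/-- The number of (positive) parts. -/
def length (l : Ptn) : ℕ := Multiset.card l.parts

/-- The size `|λ|`, i.e. the number being partitioned. -/
def size (l : Ptn) : ℕ := l.parts.sum

/-- A partition is strict if all its parts are distinct. -/
def Strict (l : Ptn) : Prop := l.parts.Nodup

/-- The conjugate partition. -/
def conj (l : Ptn) : Ptn :=
  of ((Multiset.range (l.part 0)).map
    (fun j => Multiset.card (l.parts.filter (fun x => j < x))))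

end Ptn

/-- The rectangular partition `□(n,m)` with `n` rows of length `m`. -/
def rect (n m : ℕ) : Ptn := Ptn.of (Multiset.replicate n m)

/-- The partition obtained by multiplying every part by `r`. -/
def scaleP (r : ℕ) (l : Ptn) : Ptn := Ptn.of (l.parts.map (fun a => r * a))

/-- Diagram containment: every part of `small` is at most the corresponding part of `big`. -/
def Contains (big small : Ptn) : Prop := ∀ i, small.part i ≤ big.part i

/-- The beta-set (first-column hook lengths) `{λ_i + m - 1 - i : i < m}` of `l`,
computed with `m` beads (`m` at least the number of parts). -/
def betaSet (l : Ptn) (m : ℕ) : Finset ℕ :=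
  (Finset.range m).image (fun i => l.part i + (m - 1 - i))

/-- The partition encoded by a finite set of bead positions: each bead contributes a part
equal to the number of empty positions (holes) below it. -/
def ptnOfBeads (B : Finset ℕ) : Ptn :=
  Ptn.of (B.val.map (fun p => p - (B.filter (fun q => q < p)).card))

/-- Levels of the beads on runner `k` of the `r`-abacus of `l`,
drawn with `r * l.length` beads (a multiple of `r`). -/
def runnerLevels (r : ℕ) (l : Ptn) (k : ℕ) : Finset ℕ :=
  (Finset.range (l.part 0 + r * l.length + 1)).filter
    (fun s => r * s + k ∈ betaSet l (r * l.length))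

/-- The `k`-th component `λ[k]` of the `r`-quotient of `l`. -/
def quotP (r : ℕ) (l : Ptn) (k : ℕ) : Ptn := ptnOfBeads (runnerLevels r l k)

/-- The `r`-core of `l`: push all beads of the `r`-abacus down as far as possible. -/
def coreP (r : ℕ) (l : Ptn) : Ptn :=
  ptnOfBeads ((Finset.range r).biUnion
    (fun k => (Finset.range (runnerLevels r l k).card).image (fun s => r * s + k)))

/-- The key of the bead at position `p` for the `r`-numbering of the beads `B`:
a bead which is the `j`-th lowest bead on runner `k` gets key `r * j + k`. -/
def rKey (r : ℕ) (B : Finset ℕ) (p : ℕ) : ℕ :=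
  r * (B.filter (fun q => q % r = p % r ∧ q < p)).card + p % r

/-- The number of inversions between the natural (increasing-position) numbering of the
beads `B` and the numbering by increasing `key`. -/
def inversions (key : ℕ → ℕ) (B : Finset ℕ) : ℕ :=
  ((B ×ˢ B).filter (fun pq => pq.1 < pq.2 ∧ key pq.2 < key pq.1)).card

/-- Exponent of the `r`-sign `δ_r`. -/
def rSignExp (r : ℕ) (l : Ptn) : ℕ :=
  inversions (rKey r (betaSet l (r * l.length))) (betaSet l (r * l.length))

/-- The `r`-sign `δ_r(λ) ∈ {±1}`. -/
def rSign (r : ℕ) (l : Ptn) : ℤ := (-1) ^ rSignExp r l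

/-- The key of the bead at position `p` for the `3`-bar numbering of the beads `B` of the
`3`-bar abacus: first the beads of runner `0` in increasing order, then the pairs of beads
on runners `2` and `1` paired off by increasing level (runner-`2` bead before
runner-`1` bead), then the remaining unpaired beads in increasing order. -/
def barKey (B : Finset ℕ) (p : ℕ) : ℕ :=
  let n0 := (B.filter (fun q => q % 3 = 0)).card
  let t := min ((B.filter (fun q => q % 3 = 1)).card)
              ((B.filter (fun q => q % 3 = 2)).card)
  let rk := (B.filter (fun q => q % 3 = p % 3 ∧ q < p)).card
  if p % 3 = 0 then rk
  else if rk < t then (if p % 3 = 2 then n0 + 2 * rk else n0 + 2 * rk + 1)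
  else n0 + 2 * t + (rk - t)

/-- Exponent of the `3`-bar sign `δ̄_3`.  The beads of the `3`-bar abacus of a strict
partition sit at the positions given by the parts. -/
def barSignExp (l : Ptn) : ℕ :=
  inversions (barKey l.parts.toFinset) l.parts.toFinset

/-- The `3`-bar sign `δ̄_3(λ) ∈ {±1}` of a strict partition. -/
def barSign3 (l : Ptn) : ℤ := (-1) ^ barSignExp l

/-- The double `D(λ) = (λ_1,…,λ_l | λ_1 - 1,…,λ_l - 1)` (Frobenius notation)
of a strict partition `λ`, constructed row by row. -/
noncomputable def double (l : Ptn) : Ptn :=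
  Ptn.of ((Multiset.range (l.length + l.part 0)).map (fun i =>
    (if i < l.length then l.part i + 1 else 0) +
      ((Finset.range (min i l.length)).filter (fun j => i + 1 ≤ j + l.part j)).card))

/-- The second component `λ^b[1] = D(λ)[1]` of the `3`-bar quotient of a strict
partition `λ`. -/
noncomputable def barQuot1 (l : Ptn) : Ptn := quotP 3 (double l) 1

/-- The staircase-like strict partition `Λ_ℓ = (3ℓ-2, 3ℓ-5, …, 7, 4, 1)`. -/
def LamP (ℓ : ℕ) : Ptn := Ptn.of ((Multiset.range ℓ).map (fun i => 3 * i + 1))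

/-- The staircase partition `Δ_ℓ = (ℓ, ℓ-1, …, 1)`. -/
def DelP (ℓ : ℕ) : Ptn := Ptn.of (Multiset.range (ℓ + 1))

/-- `F_1^m(Λ_ℓ)`: strict partitions obtained from `Λ_ℓ` by adding `m` cells, each
labelled `1`, where the cell in (0-indexed) column `j` is labelled `1` iff `j % 3 = 1`
(each row reads `0,1,0,0,1,0,…`). -/
def F1Lam (ℓ m : ℕ) : Set Ptn :=
  {mu | mu.Strict ∧ Contains mu (LamP ℓ) ∧ mu.size = (LamP ℓ).size + m ∧
    ∀ i j, (LamP ℓ).part i ≤ j → j < mu.part i → j % 3 = 1}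

/-- `F_1^m(Δ_ℓ)`: partitions obtained from `Δ_ℓ` by adding `m` cells, each labelled `1`,
where the cell `(i,j)` is labelled `1` iff `i + j` is odd. -/
def F1Del (ℓ m : ℕ) : Set Ptn :=
  {mu | Contains mu (DelP ℓ) ∧ mu.size = (DelP ℓ).size + m ∧
    ∀ i j, (DelP ℓ).part i ≤ j → j < mu.part i → (i + j) % 2 = 1}

/-- `(α, β)` is complementary relative to the rectangle `□(n,m)`:
`α ⊆ □(n,m)` and `β_i = m - α_{n+1-i}` for `1 ≤ i ≤ n` (0-indexed below). -/
def Complementary (n m : ℕ) (a b : Ptn) : Prop :=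
  a.length ≤ n ∧ a.part 0 ≤ m ∧ b.length ≤ n ∧
    ∀ i < n, b.part i = m - a.part (n - 1 - i)

/-- `W(n,m)`: the set of `(n,m)`-balanced partitions, i.e. partitions of `2nm` with at
most `2n` parts satisfying `μ_i + μ_{2n+1-i} = 2m` for `1 ≤ i ≤ n` (0-indexed below). -/
def W (n m : ℕ) : Set Ptn :=
  {mu | mu.size = 2 * n * m ∧ mu.length ≤ 2 * n ∧
    ∀ i < n, mu.part i + mu.part (2 * n - 1 - i) = 2 * m}

/-! ### The ring of symmetric functions

We realise the ring of symmetric functions (with rational coefficients) as the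
polynomial ring `ℚ[p_1, p_2, …]` in the power sums: the variable `X n` of
`MvPolynomial ℕ ℚ` stands for the power sum `p_{n+1}`. -/

abbrev SymF := MvPolynomial ℕ ℚ

open MvPolynomial

/-- `z_ρ = ∏ a^{m_a} m_a!` for a partition given as a multiset `ρ`. -/
def zval (s : Multiset ℕ) : ℚ :=
  s.toFinset.prod (fun a => (a : ℚ) ^ s.count a * (Nat.factorial (s.count a) : ℚ))

/-- The power sum product `p_ρ` of a multiset `ρ`. -/
noncomputable def pMult (s : Multiset ℕ) : SymF :=
  (s.map (fun a => (X (a - 1) : SymF))).prod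

/-- The complete homogeneous symmetric function `h_n = Σ_{ρ ⊢ n} z_ρ⁻¹ p_ρ`. -/
noncomputable def hSym (n : ℕ) : SymF :=
  ∑ ρ : Nat.Partition n, (zval ρ.parts)⁻¹ • pMult ρ.parts

/-- `h_k` for an integer index, vanishing for negative `k`. -/
noncomputable def hz (k : ℤ) : SymF := if k < 0 then 0 else hSym k.toNat

/-- The Schur function `S_λ`, via the Jacobi–Trudi formula
`S_λ = det(h_{λ_i - i + j})`. -/
noncomputable def schur (l : Ptn) : SymF :=
  Matrix.det (Matrix.of (fun i j : Fin l.length =>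
    hz ((l.part i.val : ℤ) + (j.val : ℤ) - (i.val : ℤ))))

/-- The plethysm `p_r ∘ f`: the algebra endomorphism sending each power sum `p_k`
to `p_{rk}`, i.e. substituting `x_i^r` for each variable `x_i`. -/
noncomputable def pleth (r : ℕ) (f : SymF) : SymF :=
  MvPolynomial.aeval (fun n => (X (r * (n + 1) - 1) : SymF)) f

/-- The `z`-weight of a power-sum monomial (exponent vector `d`). -/
def zfac (d : ℕ →₀ ℕ) : ℚ :=
  d.prod (fun i e => ((i : ℚ) + 1) ^ e * (Nat.factorial e : ℚ))

/-- The Hall inner product, for which `⟨p_ρ, p_σ⟩ = δ_{ρσ} z_ρ` and the Schur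
functions are orthonormal. -/
noncomputable def hall (f g : SymF) : ℚ :=
  f.support.sum (fun d => f.coeff d * g.coeff d * zfac d)

/-- The multi-Littlewood–Richardson coefficient `LR^λ_{μ^0,…,μ^{r-1}}`:
the multiplicity of `S_λ` in `S_{μ^0} ⋯ S_{μ^{r-1}}`. -/
noncomputable def LRmulti (lam : Ptn) (r : ℕ) (q : ℕ → Ptn) : ℚ :=
  hall ((Finset.range r).prod (fun k => schur (q k))) (schur lam)

/-- The Littlewood–Richardson coefficient `LR^λ_{α,β}`:
the multiplicity of `S_λ` in `S_α · S_β`. -/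
noncomputable def LR2 (lam a b : Ptn) : ℚ := hall (schur a * schur b) (schur lam)

/-- The irreducible symmetric group character `χ^μ(ρ)`, via the Frobenius formula
`χ^μ_ρ = ⟨S_μ, p_ρ⟩`. -/
noncomputable def chi (mu rho : Ptn) : ℚ := hall (schur mu) (pMult rho.parts)

/-- Symmetric functions in two alphabets `u`, `v`: `X (inl n)` is `p_{n+1}(u)` and
`X (inr n)` is `p_{n+1}(v)`. -/
abbrev SymF2 := MvPolynomial (ℕ ⊕ ℕ) ℚ

/-- `f ↦ f(u)`. -/
noncomputable def toU : SymF →ₐ[ℚ] SymF2 :=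
  aeval (fun n => (X (Sum.inl n) : SymF2))

/-- `f ↦ f(v)`. -/
noncomputable def toV : SymF →ₐ[ℚ] SymF2 :=
  aeval (fun n => (X (Sum.inr n) : SymF2))

/-- `f ↦ f(u - v)`, the difference of alphabets: `p_k ↦ p_k(u) - p_k(v)`. -/
noncomputable def toUV : SymF →ₐ[ℚ] SymF2 :=
  aeval (fun n => (X (Sum.inl n) : SymF2) - X (Sum.inr n))

theorem zfac_add_single (d : ℕ →₀ ℕ) (k : ℕ) :
    zfac (d + Finsupp.single k 1) = ((k : ℚ) + 1) * ((d k : ℚ) + 1) * zfac d := by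
  classical
  have key : ∀ e : ℕ →₀ ℕ, zfac e =
      ((k : ℚ) + 1) ^ e k * (Nat.factorial (e k) : ℚ) * zfac (e.erase k) := by
    intro e
    exact (Finsupp.mul_prod_erase' e k _ (by simp)).symm
  rw [key (d + Finsupp.single k 1), key d, Finsupp.erase_add, Finsupp.erase_single, add_zero]
  simp only [Finsupp.add_apply, Finsupp.single_eq_same, Nat.factorial_succ, pow_succ]
  push_cast
  ring

theorem zfac_ne_zero (d : ℕ →₀ ℕ) : zfac d ≠ 0 := by
  refine Finset.prod_ne_zero_iff.mpr fun i _ => ?_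
  positivity

theorem hall_eq_sum {f : SymF} (g : SymF) {s : Finset (ℕ →₀ ℕ)} (hs : f.support ⊆ s) :
    hall f g = ∑ d ∈ s, f.coeff d * g.coeff d * zfac d := by
  refine Finset.sum_subset hs fun d _ hd => ?_
  simp [MvPolynomial.notMem_support_iff.mp hd]

theorem hall_add_left (f f' g : SymF) : hall (f + f') g = hall f g + hall f' g := by
  classical
  rw [hall_eq_sum g (MvPolynomial.support_add (p := f) (q := f')),
    hall_eq_sum g (Finset.subset_union_left (s₁ := f.support) (s₂ := f'.support)),
    hall_eq_sum g (Finset.subset_union_right (s₁ := f.support) (s₂ := f'.support)),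
    ← Finset.sum_add_distrib]
  exact Finset.sum_congr rfl fun d _ => by rw [coeff_add]; ring

theorem hall_monomial (d : ℕ →₀ ℕ) (c : ℚ) (g : SymF) :
    hall (monomial d c) g = c * g.coeff d * zfac d := by
  classical
  rw [hall_eq_sum g MvPolynomial.support_monomial_subset]
  simp

/-- The Hall inner product against a fixed symmetric function, as a linear form. -/
noncomputable def hallLin (f : SymF) : SymF →ₗ[ℚ] ℚ where
  toFun := hall f
  map_add' g g' := by
    simp only [hall, coeff_add, ← Finset.sum_add_distrib]
    exact Finset.sum_congr rfl fun d _ => by ring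
  map_smul' c g := by
    simp only [hall, coeff_smul, smul_eq_mul, Finset.mul_sum, RingHom.id_apply]
    exact Finset.sum_congr rfl fun d _ => by ring

theorem hallLin_apply (f g : SymF) : hallLin f g = hall f g := rfl

/-- Multiplication by the power sum `p_{k+1}` is adjoint to `(k + 1) ∂/∂p_{k+1}`. -/
theorem hall_mul_X (f g : SymF) (k : ℕ) :
    hall (f * X k) g = ((k : ℚ) + 1) * hall f (pderiv k g) := by
  induction f using MvPolynomial.induction_on' with
  | monomial d c =>
    have hX : monomial d c * (X k : SymF) = monomial (d + Finsupp.single k 1) c := by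
      rw [X, monomial_mul, mul_one]
    rw [hX, hall_monomial, hall_monomial, coeff_pderiv, zfac_add_single]
    ring
  | add p q hp hq => rw [add_mul, hall_add_left, hp, hq, hall_add_left]; ring

/-- The degree of the power sum monomial with exponents `d`. -/
noncomputable def powerSumDegree : (ℕ →₀ ℕ) →+ ℕ :=
  Finsupp.liftAddHom fun i => AddMonoidHom.mulRight (i + 1)

theorem powerSumDegree_single (k c : ℕ) :
    powerSumDegree (Finsupp.single k c) = c * (k + 1) := by
  simp [powerSumDegree]

theorem powerSumDegree_apply (d : ℕ →₀ ℕ) :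
    powerSumDegree d = ∑ i ∈ d.support, d i * (i + 1) := rfl

theorem powerSumDegree_eq_sum_toMultiset (d : ℕ →₀ ℕ) :
    powerSumDegree d = (d.toMultiset.map (· + 1)).sum := by
  induction d using Finsupp.induction_linear with
  | zero => simp
  | add f g hf hg => simp [hf, hg]
  | single a b => simp [powerSumDegree_single, Multiset.map_nsmul, Multiset.sum_nsmul]

theorem zval_map_succ (d : ℕ →₀ ℕ) : zval (d.toMultiset.map (· + 1)) = zfac d := by
  classical
  have hinj : Function.Injective (· + 1 : ℕ → ℕ) := add_left_injective 1
  rw [zval, zfac, Finsupp.prod, Multiset.toFinset_map, Finset.prod_image hinj.injOn,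
    Finsupp.toFinset_toMultiset]
  refine Finset.prod_congr rfl fun i _ => ?_
  rw [Multiset.count_map_eq_count' _ _ hinj, Finsupp.count_toMultiset]
  push_cast
  rfl

theorem pMult_map_succ (d : ℕ →₀ ℕ) : pMult (d.toMultiset.map (· + 1)) = monomial d 1 := by
  rw [pMult, Multiset.map_map]
  simp only [Function.comp_def, Nat.add_sub_cancel]
  rw [Finsupp.toMultiset_map, Finsupp.prod_toMultiset, Finsupp.prod_mapDomain_index (by simp)
    (by intros; rw [pow_add]), monomial_eq]
  simp

theorem Multiset.exists_toMultiset_map_succ (s : Multiset ℕ) (hs : ∀ x ∈ s, 0 < x) :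
    ∃ d : ℕ →₀ ℕ, d.toMultiset.map (· + 1) = s := by
  refine ⟨Multiset.toFinsupp (s.map (· - 1)), ?_⟩
  rw [Multiset.toFinsupp_toMultiset, Multiset.map_map]
  conv_rhs => rw [← Multiset.map_id s]
  exact Multiset.map_congr rfl fun x hx => Nat.sub_add_cancel (hs x hx)

theorem coeff_hSym (n : ℕ) (d : ℕ →₀ ℕ) :
    (hSym n).coeff d = if powerSumDegree d = n then (zfac d)⁻¹ else 0 := by
  classical
  have hterm : ∀ ρ : Nat.Partition n, coeff d ((zval ρ.parts)⁻¹ • pMult ρ.parts) =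
      if d.toMultiset.map (· + 1) = ρ.parts then (zfac d)⁻¹ else 0 := by
    intro ρ
    obtain ⟨e, he⟩ := Multiset.exists_toMultiset_map_succ ρ.parts fun x hx => ρ.parts_pos hx
    rw [← he, zval_map_succ, pMult_map_succ, coeff_smul, coeff_monomial, smul_eq_mul]
    have hiff : d.toMultiset.map (· + 1) = e.toMultiset.map (· + 1) ↔ e = d := by
      rw [(Multiset.map_injective (add_left_injective 1)).eq_iff, eq_comm]
      exact Finsupp.orderIsoMultiset.injective.eq_iff
    simp only [hiff]
    split_ifs with h <;> simp [h]
  rw [hSym, coeff_sum, Finset.sum_congr rfl fun ρ _ => hterm ρ]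
  split_ifs with h
  · let ρ : Nat.Partition n := ⟨d.toMultiset.map (· + 1), by simp,
      by rw [← powerSumDegree_eq_sum_toMultiset, h]⟩
    rw [Finset.sum_eq_single ρ]
    · simp [ρ]
    · intro σ _ hσ
      rw [if_neg]
      exact fun h' => hσ (Nat.Partition.ext h'.symm)
    · simp
  · refine Finset.sum_eq_zero fun ρ _ => if_neg fun h' => h ?_
    rw [powerSumDegree_eq_sum_toMultiset, h', ρ.parts_sum]

theorem hSym_zero : hSym 0 = 1 := by
  ext d
  rw [coeff_hSym, coeff_one]
  have hiff : powerSumDegree d = 0 ↔ 0 = d := by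
    rw [powerSumDegree_apply, Finset.sum_eq_zero_iff]
    constructor
    · intro h
      ext i
      by_contra hi
      have := h i (Finsupp.mem_support_iff.mpr (Ne.symm hi))
      simp_all
    · rintro rfl; simp
  simp only [hiff]
  split_ifs with h
  · subst h; simp [zfac]
  · rfl

theorem hz_natCast (n : ℕ) : hz n = hSym n := by simp [hz]

theorem hz_of_neg {k : ℤ} (h : k < 0) : hz k = 0 := if_pos h

theorem coeff_hz (k : ℤ) (d : ℕ →₀ ℕ) :
    (hz k).coeff d = if (powerSumDegree d : ℤ) = k then (zfac d)⁻¹ else 0 := by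
  rcases lt_or_ge k 0 with hk | hk
  · rw [hz_of_neg hk, if_neg (by lia), coeff_zero]
  · lift k to ℕ using hk
    rw [hz_natCast, coeff_hSym]
    simp

theorem pderiv_hz (k : ℕ) (z : ℤ) :
    ((k : ℚ) + 1) • pderiv k (hz z) = hz (z - (k + 1)) := by
  ext d
  rw [coeff_smul, coeff_pderiv, coeff_hz, coeff_hz, zfac_add_single, map_add,
    powerSumDegree_single, smul_eq_mul]
  have h : ((powerSumDegree d + 1 * (k + 1) : ℕ) : ℤ) = z ↔
      (powerSumDegree d : ℤ) = z - (k + 1) := by push_cast; constructor <;> intro h <;> linarith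
  simp only [h]
  have hd := zfac_ne_zero d
  have h1 : (k : ℚ) + 1 ≠ 0 := by positivity
  have h2 : (d k : ℚ) + 1 ≠ 0 := by positivity
  split_ifs
  · field_simp
  · simp

/-- Newton's identity `n h_n = ∑ p_k h_{n-k}`. -/
theorem succ_smul_hSym (n : ℕ) :
    ((n : ℚ) + 1) • hSym (n + 1) = ∑ k ∈ Finset.range (n + 1), X k * hSym (n - k) := by
  classical
  ext d
  rw [coeff_smul, coeff_sum, coeff_hSym, smul_eq_mul]
  have hterm : ∀ k ∈ Finset.range (n + 1), coeff d (X k * hSym (n - k)) =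
      if powerSumDegree d = n + 1 then (d k * (k + 1) : ℚ) * (zfac d)⁻¹ else 0 := by
    intro k hk
    have hk' := Finset.mem_range.mp hk
    rw [coeff_X_mul']
    split_ifs with h1 h2 h2
    · obtain ⟨e, rfl⟩ : ∃ e, d = e + Finsupp.single k 1 :=
        ⟨d - Finsupp.single k 1, (tsub_add_cancel_of_le (by
          rw [Finsupp.single_le_iff]
          exact Nat.one_le_iff_ne_zero.mpr (Finsupp.mem_support_iff.mp h1))).symm⟩
      rw [map_add, powerSumDegree_single] at h2
      rw [add_tsub_cancel_right, coeff_hSym, if_pos (by lia), zfac_add_single]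
      have hd := zfac_ne_zero e
      have h1 : (k : ℚ) + 1 ≠ 0 := by positivity
      have h2 : (e k : ℚ) + 1 ≠ 0 := by positivity
      simp only [Finsupp.add_apply, Finsupp.single_eq_same]
      push_cast
      field_simp
    · obtain ⟨e, rfl⟩ : ∃ e, d = e + Finsupp.single k 1 :=
        ⟨d - Finsupp.single k 1, (tsub_add_cancel_of_le (by
          rw [Finsupp.single_le_iff]
          exact Nat.one_le_iff_ne_zero.mpr (Finsupp.mem_support_iff.mp h1))).symm⟩
      rw [map_add, powerSumDegree_single] at h2
      rw [add_tsub_cancel_right, coeff_hSym, if_neg (by lia)]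
    · simp [Finsupp.notMem_support_iff.mp h1]
    · rfl
  rw [Finset.sum_congr rfl hterm]
  split_ifs with h
  · rw [← Finset.sum_mul]
    congr 1
    have hsub : d.support ⊆ Finset.range (n + 1) := by
      intro i hi
      have h1 : d i * (i + 1) ≤ powerSumDegree d := by
        rw [powerSumDegree_apply]
        exact Finset.single_le_sum (f := fun i => d i * (i + 1)) (fun _ _ => Nat.zero_le _) hi
      have h2 := Nat.one_le_iff_ne_zero.mpr (Finsupp.mem_support_iff.mp hi)
      rw [Finset.mem_range]
      nlinarith
    rw [powerSumDegree_apply, Finset.sum_subset hsub fun i _ hi => by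
      simp [Finsupp.notMem_support_iff.mp hi]] at h
    exact_mod_cast h.symm
  · simp

/-- Evaluation of a symmetric function in `n` variables. -/
noncomputable def evalVars (n : ℕ) : SymF →ₐ[ℚ] MvPolynomial (Fin n) ℚ :=
  aeval fun k => ∑ i, X i ^ (k + 1)

theorem evalVars_X (n k : ℕ) : evalVars n (X k) = ∑ i, X i ^ (k + 1) := aeval_X _ _

/-- The coefficient of a monomial with integer exponents, zero if some exponent is negative. -/
noncomputable def intCoeff {n : ℕ} (ν : Fin n → ℤ) : MvPolynomial (Fin n) ℚ →ₗ[ℚ] ℚ :=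
  if ∀ i, 0 ≤ ν i then lcoeff ℚ (Finsupp.equivFunOnFinite.symm fun i => (ν i).toNat) else 0

theorem intCoeff_of_nonneg {n : ℕ} {ν : Fin n → ℤ} (h : ∀ i, 0 ≤ ν i)
    (p : MvPolynomial (Fin n) ℚ) :
    intCoeff ν p = coeff (Finsupp.equivFunOnFinite.symm fun i => (ν i).toNat) p := by
  rw [intCoeff, if_pos h, lcoeff_apply]

theorem intCoeff_of_not_nonneg {n : ℕ} {ν : Fin n → ℤ} (h : ¬ ∀ i, 0 ≤ ν i)
    (p : MvPolynomial (Fin n) ℚ) : intCoeff ν p = 0 := by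
  rw [intCoeff, if_neg h, LinearMap.zero_apply]

theorem intCoeff_C {n : ℕ} (ν : Fin n → ℤ) (c : ℚ) :
    intCoeff ν (C c) = if ν = 0 then c else 0 := by
  by_cases h : ∀ i, 0 ≤ ν i
  · rw [intCoeff_of_nonneg h, coeff_C]
    have hiff : 0 = Finsupp.equivFunOnFinite.symm (fun i => (ν i).toNat) ↔ ν = 0 := by
      rw [Finsupp.ext_iff, funext_iff]
      refine forall_congr' fun i => ?_
      have := h i
      simp only [Finsupp.coe_zero, Pi.zero_apply, Finsupp.equivFunOnFinite_symm_apply_apply]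
      lia
    simp only [hiff]
  · rw [intCoeff_of_not_nonneg h, if_neg]
    rintro rfl
    exact h fun i => le_rfl

theorem intCoeff_monomial_mul {n : ℕ} (ν : Fin n → ℤ) (e : Fin n →₀ ℕ)
    (p : MvPolynomial (Fin n) ℚ) :
    intCoeff ν (monomial e 1 * p) = intCoeff (fun i => ν i - e i) p := by
  by_cases h : ∀ i, 0 ≤ ν i - (e i : ℤ)
  · have h' : ∀ i, 0 ≤ ν i := fun i => by have := h i; lia
    rw [intCoeff_of_nonneg h, intCoeff_of_nonneg h', coeff_monomial_mul', if_pos, one_mul]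
    · congr 1
      ext i
      have := h i
      simp only [Finsupp.tsub_apply, Finsupp.equivFunOnFinite_symm_apply_apply]
      lia
    · intro i
      have := h i
      simp only [Finsupp.equivFunOnFinite_symm_apply_apply]
      lia
  · rw [intCoeff_of_not_nonneg h]
    by_cases h' : ∀ i, 0 ≤ ν i
    · rw [intCoeff_of_nonneg h', coeff_monomial_mul', if_neg]
      intro hle
      refine h fun i => ?_
      have h1 := hle i
      have h2 := h' i
      simp only [Finsupp.equivFunOnFinite_symm_apply_apply] at h1
      lia
    · rw [intCoeff_of_not_nonneg h']

theorem intCoeff_prod_X_pow_mul {n : ℕ} (ν : Fin n → ℤ) (e : Fin n → ℕ)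
    (p : MvPolynomial (Fin n) ℚ) :
    intCoeff ν ((∏ i, X i ^ e i) * p) = intCoeff (fun i => ν i - e i) p := by
  have h : ∏ i, (X i : MvPolynomial (Fin n) ℚ) ^ e i =
      monomial (Finsupp.equivFunOnFinite.symm e) 1 := by
    rw [monomial_eq, Finsupp.prod_fintype _ _ (by simp)]
    simp
  rw [h, intCoeff_monomial_mul]
  simp

theorem Derivation.map_finset_prod {R A ι : Type*} [CommSemiring R] [CommSemiring A] [Algebra R A]
    [DecidableEq ι] (D : Derivation R A A) (s : Finset ι) (f : ι → A) :
    D (∏ i ∈ s, f i) = ∑ i ∈ s, (∏ j ∈ s.erase i, f j) * D (f i) := by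
  induction s using Finset.induction_on with
  | empty => simp
  | insert a s ha ih =>
    rw [Finset.prod_insert ha, D.leibniz, ih, Finset.sum_insert ha, Finset.erase_insert ha,
      smul_eq_mul, smul_eq_mul, Finset.mul_sum, add_comm]
    congr 1
    refine Finset.sum_congr rfl fun i hi => ?_
    have hai : a ≠ i := fun h => ha (h ▸ hi)
    rw [Finset.erase_insert_of_ne hai, Finset.prod_insert (by simp [ha]), mul_assoc]

/-- The inner product with `∏ h_{ν i}` extracts the coefficient of `x ^ ν`. -/
theorem hall_prod_hz {n : ℕ} (f : SymF) (ν : Fin n → ℤ) :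
    hall f (∏ i, hz (ν i)) = intCoeff ν (evalVars n f) := by
  classical
  induction f using MvPolynomial.induction_on generalizing ν with
  | C c =>
    have hc : evalVars n (C c) = C c := (evalVars n).commutes c
    rw [hc, intCoeff_C, ← monomial_zero', hall_monomial]
    have h0 : coeff 0 (∏ i, hz (ν i)) = if ν = 0 then 1 else 0 := by
      rw [← constantCoeff_eq, map_prod]
      have : ∀ i, constantCoeff (hz (ν i)) = if ν i = 0 then 1 else 0 := by
        intro i
        rw [constantCoeff_eq, coeff_hz]
        simp [zfac, eq_comm]
      rw [Finset.prod_congr rfl fun i _ => this i, Finset.prod_ite_zero]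
      simp [funext_iff]
    rw [h0]
    simp [zfac]
  | add p q hp hq => rw [hall_add_left, hp, hq, map_add, map_add]
  | mul_X p k ih =>
    rw [hall_mul_X, map_mul, evalVars_X, Finset.mul_sum, map_sum, ← smul_eq_mul, ← hallLin_apply,
      ← map_smul, Derivation.map_finset_prod, Finset.smul_sum, map_sum]
    refine Finset.sum_congr rfl fun i _ => ?_
    rw [← mul_smul_comm, pderiv_hz, mul_comm (evalVars n p), X_pow_eq_monomial,
      intCoeff_monomial_mul, ← ih, hallLin_apply, ← Finset.prod_erase_mul _ _ (Finset.mem_univ i)]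
    congr 2
    · refine Finset.prod_congr rfl fun j hj => ?_
      simp [Finsupp.single_eq_of_ne (Finset.ne_of_mem_erase hj)]
    · simp

/-- The generating function of the complete homogeneous polynomials in `n` variables. -/
noncomputable def hSeries (n : ℕ) : PowerSeries (MvPolynomial (Fin n) ℚ) :=
  PowerSeries.mk fun k => evalVars n (hSym k)

/-- The polynomial `∏ (1 - x_i t)` over `i ∈ s`. -/
noncomputable def eSeries {n : ℕ} (s : Finset (Fin n)) : Polynomial (MvPolynomial (Fin n) ℚ) :=
  ∏ i ∈ s, (1 - Polynomial.C (X i) * Polynomial.X)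

theorem natDegree_eSeries_le {n : ℕ} (s : Finset (Fin n)) : (eSeries s).natDegree ≤ s.card := by
  rw [Finset.card_eq_sum_ones]
  refine (Polynomial.natDegree_prod_le _ _).trans (Finset.sum_le_sum fun i _ => ?_)
  compute_degree

theorem coe_eSeries_insert {n : ℕ} {s : Finset (Fin n)} {i : Fin n} (hi : i ∉ s) :
    (eSeries (insert i s)).toPowerSeries =
      (1 - PowerSeries.C (X i) * PowerSeries.X) * (eSeries s).toPowerSeries := by
  rw [eSeries, Finset.prod_insert hi, Polynomial.coe_mul, ← eSeries]
  simp

theorem one_sub_mul_mk_pow {R : Type*} [CommRing R] (x : R) :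
    (1 - PowerSeries.C x * PowerSeries.X) * PowerSeries.mk (fun k => x ^ k) = 1 := by
  ext k
  cases k with
  | zero => simp
  | succ k =>
    rw [sub_mul, one_mul, mul_assoc, map_sub, PowerSeries.coeff_C_mul,
      PowerSeries.coeff_succ_X_mul, PowerSeries.coeff_mk, PowerSeries.coeff_mk,
      PowerSeries.coeff_one, pow_succ']
    simp

theorem derivative_coe_eSeries {n : ℕ} (s : Finset (Fin n)) :
    PowerSeries.derivative _ (eSeries s).toPowerSeries =
      -((∑ i ∈ s, PowerSeries.C (X i) * PowerSeries.mk fun k => X i ^ k) * (eSeries s).toPowerSeries) := by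
  induction s using Finset.induction_on with
  | empty => simp [eSeries]
  | insert i s hi ih =>
    rw [coe_eSeries_insert hi, Derivation.leibniz, ih, Finset.sum_insert hi, map_sub,
      Derivation.leibniz, PowerSeries.derivative_C, PowerSeries.derivative_X,
      PowerSeries.derivative_one]
    simp only [smul_eq_mul, mul_zero, add_zero, mul_one, zero_sub]
    linear_combination
      (PowerSeries.C (X i) * (eSeries s).toPowerSeries) *
        one_sub_mul_mk_pow (X i : MvPolynomial (Fin n) ℚ)

theorem derivative_hSeries (n : ℕ) :
    PowerSeries.derivative _ (hSeries n) =
      (∑ i, PowerSeries.C (X i) * PowerSeries.mk fun k => X i ^ k) * hSeries n := by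
  ext1 a
  have hP : (∑ i : Fin n, PowerSeries.C (X i : MvPolynomial (Fin n) ℚ) *
      PowerSeries.mk fun k => X i ^ k) = PowerSeries.mk fun k => evalVars n (X k) := by
    ext1 k
    simp [map_sum, evalVars_X, pow_succ']
  rw [hP, PowerSeries.coeff_derivative, PowerSeries.coeff_mul,
    Finset.Nat.sum_antidiagonal_eq_sum_range_succ_mk]
  have h := congrArg (evalVars n) (succ_smul_hSym a)
  simp only [map_smul, map_sum, map_mul] at h
  simp only [hSeries, PowerSeries.coeff_mk]
  rw [Nat.succ_eq_add_one, ← h, Algebra.smul_def, mul_comm]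
  simp

theorem hSeries_mul_eSeries_univ (n : ℕ) :
    hSeries n * (eSeries (Finset.univ : Finset (Fin n))).toPowerSeries = 1 := by
  apply PowerSeries.derivative.ext
  · rw [Derivation.leibniz, derivative_coe_eSeries, derivative_hSeries,
      PowerSeries.derivative_one]
    simp only [smul_eq_mul]
    ring
  · simp [hSeries, hSym_zero, eSeries, Polynomial.constantCoeff_coe, Polynomial.coeff_zero_prod]

theorem hSeries_mul_eSeries_erase {n : ℕ} (j : Fin n) :
    hSeries n * (eSeries (Finset.univ.erase j)).toPowerSeries = PowerSeries.mk fun k => X j ^ k := by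
  have h := hSeries_mul_eSeries_univ n
  rw [← Finset.insert_erase (Finset.mem_univ j), coe_eSeries_insert (by simp)] at h
  have h' := one_sub_mul_mk_pow (X j : MvPolynomial (Fin n) ℚ)
  linear_combination (PowerSeries.mk fun k => (X j : MvPolynomial (Fin n) ℚ) ^ k) * h -
    (hSeries n * (eSeries (Finset.univ.erase j)).toPowerSeries) * h'

theorem sum_hz_mul_coeff {n N : ℕ} (p : Polynomial (MvPolynomial (Fin n) ℚ))
    (hp : p.natDegree < N) (a : ℕ) :
    ∑ k : Fin N, evalVars n (hz (a - k)) * p.coeff k = PowerSeries.coeff a (hSeries n * p.toPowerSeries) := by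
  rw [mul_comm (hSeries n), PowerSeries.coeff_mul,
    Finset.Nat.sum_antidiagonal_eq_sum_range_succ_mk,
    Fin.sum_univ_eq_sum_range (fun k => evalVars n (hz (a - k)) * p.coeff k)]
  have h1 : ∑ k ∈ Finset.range N, evalVars n (hz (a - k)) * p.coeff k =
      ∑ k ∈ Finset.range (N + a + 1), evalVars n (hz (a - k)) * p.coeff k := by
    refine Finset.sum_subset (Finset.range_subset_range.mpr (by lia)) fun k _ hk => ?_
    rw [Finset.mem_range, not_lt] at hk
    rw [Polynomial.coeff_eq_zero_of_natDegree_lt (by lia), mul_zero]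
  have h2 : ∑ k ∈ Finset.range (a + 1), evalVars n (hz (a - k)) * p.coeff k =
      ∑ k ∈ Finset.range (N + a + 1), evalVars n (hz (a - k)) * p.coeff k := by
    refine Finset.sum_subset (Finset.range_subset_range.mpr (by lia)) fun k _ hk => ?_
    rw [Finset.mem_range, not_lt] at hk
    rw [hz_of_neg (by lia), map_zero, zero_mul]
  rw [h1, ← h2]
  refine Finset.sum_congr rfl fun k hk => ?_
  have hk' : k ≤ a := Nat.lt_succ_iff.mp (Finset.mem_range.mp hk)
  rw [← Nat.cast_sub hk', hz_natCast, hSeries, PowerSeries.coeff_mk, Polynomial.coeff_coe,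
    mul_comm]

/-- The Jacobi–Trudi matrix of a sequence of integers. -/
noncomputable def jacobiTrudi {n : ℕ} (μ : Fin n → ℤ) : Matrix (Fin n) (Fin n) SymF :=
  Matrix.of fun i j => hz (μ i + j - i)

theorem det_jacobiTrudi_zero (n : ℕ) : (jacobiTrudi (0 : Fin n → ℤ)).det = 1 := by
  rw [Matrix.det_of_isUpperTriangular]
  · refine Finset.prod_eq_one fun i _ => ?_
    simp [jacobiTrudi, hz, hSym_zero]
  · intro i j hij
    have : (j : ℕ) < i := hij
    exact hz_of_neg (by simp only [Pi.zero_apply]; lia)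

theorem jacobiTrudi_mulVec {n N : ℕ} (μ : Fin N → ℕ)
    (p : Polynomial (MvPolynomial (Fin n) ℚ)) (hp : p.natDegree < N) (i : Fin N) :
    ∑ k, evalVars n (jacobiTrudi (fun i => (μ i : ℤ)) i k) * p.coeff k.rev =
      PowerSeries.coeff (μ i + i.rev) (hSeries n * p.toPowerSeries) := by
  rw [← sum_hz_mul_coeff p hp, ← Equiv.sum_comp Fin.revPerm]
  refine Finset.sum_congr rfl fun k _ => ?_
  rw [Fin.revPerm_apply, Fin.rev_rev]
  rw [jacobiTrudi, Matrix.of_apply]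
  congr 3
  have hi := i.isLt
  have hk := k.isLt
  simp only [Fin.val_rev]
  lia

/-- The alternant `det (x_j ^ e_i)`. -/
noncomputable def alternant {n : ℕ} (e : Fin n → ℕ) : MvPolynomial (Fin n) ℚ :=
  (Matrix.of fun i j => X j ^ e i : Matrix (Fin n) (Fin n) (MvPolynomial (Fin n) ℚ)).det

theorem evalVars_det_jacobiTrudi_mul {n : ℕ} (μ : Fin n → ℕ) :
    evalVars n (jacobiTrudi fun i => (μ i : ℤ)).det *
      (Matrix.of fun k j => (eSeries (Finset.univ.erase j)).coeff (Fin.rev k : ℕ) :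
        Matrix (Fin n) (Fin n) (MvPolynomial (Fin n) ℚ)).det =
      alternant fun i => μ i + i.rev := by
  rw [AlgHom.map_det, ← Matrix.det_mul, alternant]
  congr 1
  ext1 i j
  rw [Matrix.mul_apply]
  have hdeg : (eSeries (Finset.univ.erase j)).natDegree < n := by
    have h := natDegree_eSeries_le (Finset.univ.erase j)
    rw [Finset.card_erase_of_mem (Finset.mem_univ j), Finset.card_univ, Fintype.card_fin] at h
    have := j.isLt
    lia
  have h := jacobiTrudi_mulVec μ _ hdeg i
  rw [hSeries_mul_eSeries_erase, PowerSeries.coeff_mk] at h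
  exact h

/-- The bialternant formula for the Jacobi–Trudi determinant. -/
theorem alternant_mul_evalVars_det_jacobiTrudi {n : ℕ} (μ : Fin n → ℕ) :
    alternant (fun i : Fin n => (i.rev : ℕ)) * evalVars n (jacobiTrudi fun i => (μ i : ℤ)).det =
      alternant fun i => μ i + i.rev := by
  have h := evalVars_det_jacobiTrudi_mul (0 : Fin n → ℕ)
  have h0 : (jacobiTrudi fun i : Fin n => (((0 : Fin n → ℕ) i : ℕ) : ℤ)).det = 1 :=
    det_jacobiTrudi_zero n
  rw [h0, map_one, one_mul] at h
  simp only [Pi.zero_apply, zero_add] at h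
  rw [← evalVars_det_jacobiTrudi_mul μ, h, mul_comm]

/-- A Jacobi–Trudi determinant with more positive rows than variables vanishes. -/
theorem evalVars_det_jacobiTrudi_eq_zero {n N : ℕ} (hN : n < N) (μ : Fin N → ℕ)
    (hμ : ∀ i, 0 < μ i) : evalVars n (jacobiTrudi fun i => (μ i : ℤ)).det = 0 := by
  rw [AlgHom.map_det, ← Matrix.exists_mulVec_eq_zero_iff]
  have hdeg : (eSeries (Finset.univ : Finset (Fin n))).natDegree < N :=
    (natDegree_eSeries_le _).trans_lt (by simpa using hN)
  refine ⟨fun k => (eSeries Finset.univ).coeff (k.rev : ℕ), fun h => ?_, ?_⟩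
  · have h' := congrFun h (Fin.rev ⟨0, by lia⟩)
    simp [eSeries, Polynomial.coeff_zero_prod] at h'
  · ext1 i
    have h := jacobiTrudi_mulVec μ _ hdeg i
    rw [hSeries_mul_eSeries_univ, PowerSeries.coeff_one,
      if_neg (by have := hμ i; lia)] at h
    exact h

theorem Ptn.part_mem {l : Ptn} {i : ℕ} (hi : i < l.length) : l.part i ∈ l.parts := by
  have hlen : i < (l.parts.sort (· ≤ ·)).reverse.length := by simpa [Ptn.length] using hi
  rw [Ptn.part, List.getD_eq_getElem _ _ hlen]
  exact (Multiset.mem_sort _).mp (List.mem_reverse.mp (List.getElem_mem hlen))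

theorem Ptn.part_eq_zero {l : Ptn} {i : ℕ} (hi : l.length ≤ i) : l.part i = 0 :=
  List.getD_eq_default _ _ (by simpa [Ptn.length] using hi)

theorem Ptn.part_antitone (l : Ptn) : Antitone l.part := by
  intro i j hij
  rcases le_or_gt l.length j with hj | hj
  · rw [Ptn.part_eq_zero hj]
    exact Nat.zero_le _
  · have hlen : j < (l.parts.sort (· ≤ ·)).reverse.length := by simpa [Ptn.length] using hj
    rw [Ptn.part, Ptn.part, List.getD_eq_getElem _ _ hlen,
      List.getD_eq_getElem _ _ (hij.trans_lt hlen)]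
    have hs : ((l.parts.sort (· ≤ ·)).reverse).Pairwise (· ≥ ·) := by
      rw [List.pairwise_reverse]
      exact Multiset.pairwise_sort _ _
    exact hs.rel_get_of_le (a := ⟨i, hij.trans_lt hlen⟩) (b := ⟨j, hlen⟩) hij

theorem length_rect_le (n m : ℕ) : (rect n m).length ≤ n := by
  calc (rect n m).length ≤ (Multiset.replicate n m).card :=
        Multiset.card_le_card (Multiset.filter_le (fun x => 0 < x) _)
    _ = n := Multiset.card_replicate n m

theorem part_rect {n m i : ℕ} (hi : i < n) : (rect n m).part i = m := by
  rcases Nat.eq_zero_or_pos m with rfl | hm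
  · exact Ptn.part_eq_zero (by
      simp [rect, Ptn.of, Ptn.length, Multiset.filter_eq_nil.mpr, Multiset.mem_replicate])
  · have hparts : (rect n m).parts = Multiset.replicate n m := by
      rw [rect, Ptn.of, Multiset.filter_eq_self]
      intro x hx
      rwa [Multiset.eq_of_mem_replicate hx]
    have hmem : (rect n m).part i ∈ (rect n m).parts :=
      Ptn.part_mem (by rw [Ptn.length, hparts]; simpa using hi)
    rw [hparts] at hmem
    exact Multiset.eq_of_mem_replicate hmem

/-- Appending zero parts does not change the Jacobi–Trudi determinant. -/
theorem schur_eq_det_jacobiTrudi (l : Ptn) {n : ℕ} (hn : l.length ≤ n) :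
    schur l = (jacobiTrudi fun i : Fin n => (l.part i : ℤ)).det := by
  induction n, hn using Nat.le_induction with
  | base => rfl
  | succ n hn ih =>
    rw [Matrix.det_succ_row _ (Fin.last n), Fin.sum_univ_castSucc, Finset.sum_eq_zero, zero_add]
    · have hlast : jacobiTrudi (fun i : Fin (n + 1) => (l.part i : ℤ)) (Fin.last n) (Fin.last n)
          = 1 := by
        simp [jacobiTrudi, Ptn.part_eq_zero hn, hz, hSym_zero]
      rw [hlast, ih]
      simp only [Fin.val_last, Even.neg_one_pow ⟨n, rfl⟩, one_mul]
      congr 1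
      ext1 i j
      simp [jacobiTrudi]
    · intro i _
      have hzero : jacobiTrudi (fun i : Fin (n + 1) => (l.part i : ℤ)) (Fin.last n) i.castSucc
          = 0 := by
        have := i.isLt
        refine hz_of_neg ?_
        simp only [Fin.val_last, Ptn.part_eq_zero hn, Fin.val_castSucc]
        lia
      rw [hzero, mul_zero, zero_mul]

theorem evalVars_schur_eq_zero {n : ℕ} {l : Ptn} (h : n < l.length) : evalVars n (schur l) = 0 :=
  evalVars_det_jacobiTrudi_eq_zero h _ fun i => l.pos _ (Ptn.part_mem i.isLt)

theorem intCoeff_alternant_mul {n : ℕ} (ν : Fin n → ℤ) (e : Fin n → ℕ)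
    (p : MvPolynomial (Fin n) ℚ) :
    intCoeff ν (alternant e * p) =
      ∑ σ : Equiv.Perm (Fin n),
        Equiv.Perm.sign σ • intCoeff (fun i => ν i - e (σ i)) p := by
  rw [alternant, Matrix.det_apply, Finset.sum_mul, map_sum]
  refine Finset.sum_congr rfl fun σ _ => ?_
  rw [smul_mul_assoc, Units.smul_def, Units.smul_def, map_zsmul]
  simp only [Matrix.of_apply, intCoeff_prod_X_pow_mul]

theorem hall_det_jacobiTrudi_eq_sum {n : ℕ} (f : SymF) (μ : Fin n → ℤ) :
    hall f (jacobiTrudi μ).det =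
      ∑ σ : Equiv.Perm (Fin n),
        Equiv.Perm.sign σ • intCoeff (fun i => μ i + σ i - i) (evalVars n f) := by
  rw [← Matrix.det_transpose, Matrix.det_apply, ← hallLin_apply, map_sum]
  refine Finset.sum_congr rfl fun σ _ => ?_
  rw [Units.smul_def, Units.smul_def, map_zsmul, ← hall_prod_hz, hallLin_apply]
  rfl

theorem hall_det_jacobiTrudi {n : ℕ} (f : SymF) (μ : Fin n → ℤ) :
    hall f (jacobiTrudi μ).det =
      intCoeff (fun i => μ i + (i.rev : ℕ))
        (alternant (fun i : Fin n => (i.rev : ℕ)) * evalVars n f) := by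
  rw [hall_det_jacobiTrudi_eq_sum, intCoeff_alternant_mul]
  refine Finset.sum_congr rfl fun σ _ => ?_
  congr 3
  ext i
  have h1 := i.isLt
  have h2 := (σ i).isLt
  simp only [Fin.val_rev]
  lia

/-- Coefficients of a symmetric polynomial are invariant under permuting the exponents. -/
theorem intCoeff_comp_perm_evalVars {n : ℕ} (ν : Fin n → ℤ) (π : Equiv.Perm (Fin n)) (f : SymF) :
    intCoeff (fun i => ν (π i)) (evalVars n f) = intCoeff ν (evalVars n f) := by
  rw [← hall_prod_hz, ← hall_prod_hz, Equiv.prod_comp π fun i => hz (ν i)]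

theorem alternant_mul_evalVars_schur {n : ℕ} {l : Ptn} (hl : l.length ≤ n) :
    alternant (fun i : Fin n => (i.rev : ℕ)) * evalVars n (schur l) =
      alternant fun i : Fin n => l.part i + i.rev := by
  rw [schur_eq_det_jacobiTrudi l hl, alternant_mul_evalVars_det_jacobiTrudi]

theorem eq_one_of_comp_perm_eq {n : ℕ} {u v : Fin n → ℤ} (hu : StrictAnti u) (hv : StrictAnti v)
    {σ : Equiv.Perm (Fin n)} (h : ∀ i, u i = v (σ i)) : σ = 1 := by
  have hσ : StrictMono σ := fun i j hij => hv.lt_iff_gt.mp (by rw [← h, ← h]; exact hu hij)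
  have hid : hσ.orderIsoOfSurjective σ σ.surjective = OrderIso.refl _ := Subsingleton.elim _ _
  ext1 i
  exact congrArg (fun e : Fin n ≃o Fin n => e i) hid

theorem strictAnti_add_rev {n : ℕ} {γ : Fin n → ℤ} (hγ : Antitone γ) :
    StrictAnti fun i => γ i + (i.rev : ℕ) := by
  intro i j hij
  have h1 := hγ hij.le
  have h2 : (j.rev : ℕ) < i.rev := Fin.rev_lt_rev.mpr hij
  simp only
  lia

/-- Orthonormality of Schur functions, with one index allowed to have negative entries. -/
theorem hall_schur_det_jacobiTrudi {n : ℕ} {b : Ptn} (hb : b.length ≤ n) {γ : Fin n → ℤ}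
    (hγ : Antitone γ) :
    hall (schur b) (jacobiTrudi γ).det = if ∀ i, γ i = b.part i then 1 else 0 := by
  have hbanti : Antitone fun i : Fin n => (b.part i : ℤ) := fun i j hij => by
    exact Int.ofNat_le.mpr (b.part_antitone (show (i : ℕ) ≤ j from hij))
  rw [hall_det_jacobiTrudi, alternant_mul_evalVars_schur hb, ← mul_one (alternant _),
    intCoeff_alternant_mul, Finset.sum_eq_single 1]
  · rw [← C_1, intCoeff_C]
    simp [_root_.funext_iff, sub_eq_zero]
  · intro σ _ hσ
    rw [← C_1, intCoeff_C, if_neg, smul_zero]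
    intro h
    refine hσ (eq_one_of_comp_perm_eq (strictAnti_add_rev hγ) (strictAnti_add_rev hbanti)
      fun i => ?_)
    have := congrFun h i
    simp only [Pi.zero_apply, sub_eq_zero] at this
    exact_mod_cast this
  · simp

theorem LR2_rect_eq (n m : ℕ) (a b : Ptn) :
    LR2 (rect n m) a b = intCoeff (fun i : Fin n => (m : ℤ) + (i.rev : ℕ))
      (alternant (fun i : Fin n => (i.rev : ℕ)) *
        (evalVars n (schur a) * evalVars n (schur b))) := by
  rw [LR2, schur_eq_det_jacobiTrudi _ (length_rect_le n m), hall_det_jacobiTrudi,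
    map_mul (evalVars n)]
  simp only [part_rect (Fin.isLt _)]

theorem LR2_rect {n m : ℕ} {a b : Ptn} (ha : a.length ≤ n) (hb : b.length ≤ n) :
    LR2 (rect n m) a b =
      if ∀ i : Fin n, (m : ℤ) - a.part i.rev = b.part i then 1 else 0 := by
  have hanti : Antitone fun i : Fin n => (m : ℤ) - a.part i.rev := fun i j hij => by
    have := a.part_antitone (show (j.rev : ℕ) ≤ i.rev from Fin.rev_le_rev.mpr hij)
    simp only
    lia
  rw [← hall_schur_det_jacobiTrudi hb hanti, hall_det_jacobiTrudi_eq_sum, LR2_rect_eq,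
    ← mul_assoc, alternant_mul_evalVars_schur ha, intCoeff_alternant_mul]
  have hrev : (Fin.revPerm : Equiv.Perm (Fin n)) * Fin.revPerm = 1 := by
    ext1 i
    simp
  have hinv : Function.Involutive fun σ : Equiv.Perm (Fin n) =>
      Fin.revPerm * σ⁻¹ * Fin.revPerm := fun σ => by
    have hrevinv : (Fin.revPerm : Equiv.Perm (Fin n))⁻¹ = Fin.revPerm :=
      inv_eq_of_mul_eq_one_left hrev
    simp only [mul_inv_rev, inv_inv, hrevinv]
    rw [← mul_assoc, ← mul_assoc, hrev, one_mul, mul_assoc, hrev, mul_one]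
  refine Fintype.sum_bijective _ hinv.bijective _ _ fun σ => ?_
  congr 1
  · rw [map_mul, map_mul, map_inv, Int.units_inv_eq_self, mul_comm, ← mul_assoc, ← map_mul,
      hrev, map_one, one_mul]
  · rw [← intCoeff_comp_perm_evalVars _ (σ⁻¹ * Fin.revPerm)]
    congr 2
    ext j
    simp only [Equiv.Perm.mul_apply, Fin.revPerm_apply, ← Equiv.Perm.mul_apply σ, mul_inv_cancel,
      Equiv.Perm.one_apply, Fin.rev_rev]
    push_cast
    ring

theorem complementary_iff (n m : ℕ) (a b : Ptn) :
    Complementary n m a b ↔ a.length ≤ n ∧ b.length ≤ n ∧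
      ∀ i : Fin n, (m : ℤ) - a.part i.rev = b.part i := by
  have hrev : ∀ i : Fin n, n - 1 - (i : ℕ) = i.rev := fun i => by
    rw [Fin.val_rev]
    lia
  constructor
  · rintro ⟨ha, ham, hb, h⟩
    refine ⟨ha, hb, fun i => ?_⟩
    have h1 := h i i.isLt
    rw [hrev] at h1
    have h2 := a.part_antitone (Nat.zero_le (i.rev : ℕ))
    lia
  · rintro ⟨ha, hb, h⟩
    refine ⟨ha, ?_, hb, fun i hi => ?_⟩
    · rcases Nat.eq_zero_or_pos n with rfl | hn
      · rw [Ptn.part_eq_zero ha]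
        exact Nat.zero_le _
      · have h0 := h (Fin.rev ⟨0, hn⟩)
        rw [Fin.rev_rev] at h0
        lia
    · have h1 := h ⟨i, hi⟩
      rw [← hrev] at h1
      simp only at h1
      lia

/-- Equation (4.1): `LR^{□(n,m)}_{α,β}` is `1` if `(α,β)` is complementary relative to
the rectangle `□(n,m)`, and `0` otherwise. -/
theorem stmt2 (n m : ℕ) (a b : Ptn) :
    (Complementary n m a b → LR2 (rect n m) a b = 1) ∧
    (¬ Complementary n m a b → LR2 (rect n m) a b = 0) := by
  constructor
  · intro h
    have h' := (complementary_iff n m a b).mp h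
    rw [LR2_rect h'.1 h'.2.1, if_pos h'.2.2]
  · intro h
    rw [complementary_iff] at h
    rcases le_or_gt a.length n with ha | ha
    · rcases le_or_gt b.length n with hb | hb
      · rw [LR2_rect ha hb, if_neg fun hab => h ⟨ha, hb, hab⟩]
      · rw [LR2_rect_eq, evalVars_schur_eq_zero hb, mul_zero, mul_zero, map_zero]
    · rw [LR2_rect_eq, evalVars_schur_eq_zero ha, zero_mul, mul_zero, map_zero]
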